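/- arXiv:1802.08097 — 2 statements merged into one kernel-verified Lean document; each statement's English description precedes it below -/
import Mathlib

section
/- For all integers 1 ≤ k ≤ n, every σ-orbit in Y_{k,n} contains an upper triangular diagram; consequently, every σ-orbit contains a unique minimal upper triangular diagram. -/
/-- A Young diagram inscribed in a `k × (n-k)` rectangle: a weakly decreasing
sequence `λ₁ ≥ … ≥ λ_k` (0-indexed) with all entries `≤ n - k`. -/
def IsDiagram (k n : ℕ) (lam : Fin k → ℕ) : Prop :=
  (∀ i j : Fin k, i ≤ j → lam j ≤ lam i) ∧ ∀ i, lam i ≤ n - k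

/-- The cyclic step map `σ` on diagrams: add one box to every row if the first
row is shorter than `n - k`, otherwise drop the first row and append a zero row. -/
def cyc (k n : ℕ) (lam : Fin k → ℕ) : Fin k → ℕ :=
  if ∀ i, lam i < n - k then fun i => lam i + 1
  else fun i => if h : (i : ℕ) + 1 < k then lam ⟨(i : ℕ) + 1, h⟩ else 0

/-- The orbit length `o(λ)`: the least positive `t` with `σ^[t] λ = λ`. -/
noncomputable def orbLen (k n : ℕ) (lam : Fin k → ℕ) : ℕ :=
  sInf {t | 0 < t ∧ (cyc k n)^[t] lam = lam}

/-- Upper triangular diagram: `k·λᵢ ≤ (n-k)(k-i)` for all `i` (1-indexed). -/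
def IsUpper (k n : ℕ) (lam : Fin k → ℕ) : Prop :=
  ∀ i : Fin k, k * lam i ≤ (n - k) * (k - 1 - (i : ℕ))

/-- Lexicographic (non-strict) comparison of diagrams. -/
def lexLE {k : ℕ} (lam mu : Fin k → ℕ) : Prop :=
  lam = mu ∨ ∃ t : Fin k, (∀ i, i < t → lam i = mu i) ∧ lam t < mu t

/-- Minimal upper triangular diagram: upper triangular and lexicographically
smallest among the upper triangular diagrams in its `σ`-orbit. -/
def IsMinUpper (k n : ℕ) (lam : Fin k → ℕ) : Prop :=
  IsUpper k n lam ∧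
    ∀ t : ℕ, IsUpper k n ((cyc k n)^[t] lam) → lexLE lam ((cyc k n)^[t] lam)

/-- The binary word of a diagram: position `j` (0-indexed) carries the symbol `0`
(encoded as `false`) iff `j = λ_{k-i} + i` for some `0 ≤ i ≤ k-1` (0-indexed). -/
def word (k n : ℕ) (lam : Fin k → ℕ) (j : Fin n) : Bool :=
  !decide (∃ i : Fin k, (j : ℕ) = lam i.rev + (i : ℕ))

/-- A binary word of length `n` with exactly `k` zeros (`false` encodes `0`). -/
def IsWord (k n : ℕ) (w : Fin n → Bool) : Prop :=
  (Finset.univ.filter fun j => w j = false).card = k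

/-- Rotation of a binary word: `r(w)_j = w_{j+1}`, indices mod `n`. -/
def rot {n : ℕ} (w : Fin n → Bool) (j : Fin n) : Bool :=
  w ⟨((j : ℕ) + 1) % n, Nat.mod_lt _ j.pos⟩

/-- The diagram `θ_{k,km} = ((k-1)(m-1), (k-2)(m-1), …, (m-1), 0)`. -/
def theta (k m : ℕ) : Fin k → ℕ := fun i => (k - 1 - (i : ℕ)) * (m - 1)

/-- `N_{k,n}`: the number of diagrams in `Y_{k,n}` with full orbit `o(λ) = n`. -/
noncomputable def NN (k n : ℕ) : ℕ :=
  {lam : Fin k → ℕ | IsDiagram k n lam ∧ orbLen k n lam = n}.ncard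

theorem lexLE_iff {k : ℕ} (lam mu : Fin k → ℕ) : lexLE lam mu ↔ toLex lam ≤ toLex mu := by
  rw [le_iff_eq_or_lt]
  rfl

theorem IsDiagram.map_cyc {k n : ℕ} {lam : Fin k → ℕ} (h : IsDiagram k n lam) :
    IsDiagram k n (cyc k n lam) := by
  unfold cyc
  split_ifs with h0
  · exact ⟨fun i j hij => Nat.succ_le_succ (h.1 i j hij), fun i => h0 i⟩
  · refine ⟨fun i j hij => ?_, fun i => ?_⟩
    · have hij' : (i : ℕ) ≤ j := hij
      by_cases hj : (j : ℕ) + 1 < k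
      · have hi : (i : ℕ) + 1 < k := by omega
        simp only [hi, hj, dite_true]
        exact h.1 _ _ (Fin.mk_le_mk.2 (by omega))
      · simp [hj]
    · dsimp only
      split_ifs
      · exact h.2 _
      · exact Nat.zero_le _

theorem IsDiagram.iterate_cyc {k n : ℕ} {lam : Fin k → ℕ} (h : IsDiagram k n lam) (t : ℕ) :
    IsDiagram k n ((cyc k n)^[t] lam) := by
  induction t with
  | zero => exact h
  | succ t ih => rw [Function.iterate_succ_apply']; exact ih.map_cyc

/-- A diagram whose rows are not all shorter than `n - k` has a full first row. -/
theorem IsDiagram.zero_eq {k n : ℕ} (hk : 0 < k) {lam : Fin k → ℕ} (h : IsDiagram k n lam)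
    (h0 : ¬ ∀ i, lam i < n - k) : lam ⟨0, hk⟩ = n - k := by
  push Not at h0
  obtain ⟨i, hi⟩ := h0
  exact le_antisymm (h.2 _) (hi.trans (h.1 _ _ (Fin.mk_le_mk.2 (Nat.zero_le _))))

theorem cyc_injOn {k n : ℕ} (hk : 0 < k) : Set.InjOn (cyc k n) {lam | IsDiagram k n lam} := by
  intro a ha b hb hab
  have key : ∀ i, cyc k n a i = cyc k n b i := fun i => congrFun hab i
  have last := key ⟨k - 1, by omega⟩
  by_cases h1 : ∀ i, a i < n - k <;> by_cases h2 : ∀ i, b i < n - k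
  · funext i
    simpa [cyc, h1, h2] using key i
  · have : ¬ k - 1 + 1 < k := by omega
    simp [cyc, h1, h2, this] at last
  · have : ¬ k - 1 + 1 < k := by omega
    simp [cyc, h1, h2, this] at last
  · funext ⟨i, hi⟩
    cases i with
    | zero => rw [ha.zero_eq hk h1, hb.zero_eq hk h2]
    | succ i =>
      have := key ⟨i, by omega⟩
      rw [cyc, cyc, if_neg h1, if_neg h2] at this
      simpa [hi] using this

theorem finite_setOf_isDiagram (k n : ℕ) : {lam | IsDiagram k n lam}.Finite :=
  (Set.Finite.pi' fun _ : Fin k => Set.finite_Iic (n - k)).subset fun _ h => h.2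

theorem IsDiagram.exists_isPeriodicPt {k n : ℕ} (hk : 0 < k) {lam : Fin k → ℕ}
    (h : IsDiagram k n lam) : ∃ p, 0 < p ∧ Function.IsPeriodicPt (cyc k n) p lam := by
  obtain ⟨a, -, b, -, hab, heq⟩ := Set.infinite_univ.exists_ne_map_eq_of_mapsTo
    (f := fun t => (cyc k n)^[t] lam) (fun t _ => h.iterate_cyc t)
    (finite_setOf_isDiagram k n)
  wlog hlt : a < b generalizing a b
  · exact this b a hab.symm heq.symm (by omega)
  refine ⟨b - a, by omega, ?_⟩
  have aux : ∀ s, ∀ x y, IsDiagram k n x → IsDiagram k n y →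
      (cyc k n)^[s] x = (cyc k n)^[s] y → x = y := by
    intro s
    induction s with
    | zero => exact fun x y _ _ hxy => hxy
    | succ s ih =>
      intro x y hx hy hxy
      exact cyc_injOn hk hx hy (ih _ _ hx.map_cyc hy.map_cyc hxy)
  refine (aux a _ _ h (h.iterate_cyc _) ?_).symm
  rw [← Function.iterate_add_apply, Nat.add_sub_cancel' hlt.le]
  exact heq

/-- The `σ`-orbit of a diagram is a cycle: any two of its members reach each other. -/
theorem IsDiagram.exists_iterate_iterate_eq {k n : ℕ} (hk : 0 < k) {lam : Fin k → ℕ}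
    (h : IsDiagram k n lam) (s t : ℕ) :
    ∃ r, (cyc k n)^[r] ((cyc k n)^[s] lam) = (cyc k n)^[t] lam := by
  obtain ⟨p, hp, hper⟩ := h.exists_isPeriodicPt hk
  refine ⟨t + (p - 1) * s, ?_⟩
  have hs : t + (p - 1) * s + s = t + s * p := by
    obtain ⟨q, rfl⟩ := Nat.exists_eq_add_of_lt hp
    simp only [Nat.zero_add, Nat.add_sub_cancel]
    ring
  rw [← Function.iterate_add_apply, hs, Function.iterate_add_apply, (hper.const_mul s).eq]

theorem IsDiagram.iterate_cyc_eq_add {k n : ℕ} (hk : 0 < k) {lam : Fin k → ℕ}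
    (h : IsDiagram k n lam) (s : ℕ) (hs : lam ⟨0, hk⟩ + s ≤ n - k) :
    (cyc k n)^[s] lam = fun i => lam i + s := by
  induction s with
  | zero => rfl
  | succ s ih =>
    rw [Function.iterate_succ_apply', ih (by omega), cyc, if_pos]
    · rfl
    · intro i
      have := h.1 ⟨0, hk⟩ i (Fin.mk_le_mk.2 (Nat.zero_le _))
      omega

/-- Filling up the first row and then dropping it. -/
theorem IsDiagram.iterate_cyc_drop {k n : ℕ} (hk : 0 < k) {lam : Fin k → ℕ}
    (h : IsDiagram k n lam) :
    (cyc k n)^[n - k - lam ⟨0, hk⟩ + 1] lam = fun i : Fin k =>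
      if h : (i : ℕ) + 1 < k then lam ⟨(i : ℕ) + 1, h⟩ + (n - k - lam ⟨0, hk⟩) else 0 := by
  have h0 := h.2 ⟨0, hk⟩
  rw [Function.iterate_succ_apply', h.iterate_cyc_eq_add hk _ (by omega), cyc, if_neg]
  intro hall
  have := hall ⟨0, hk⟩
  omega

/-- The extension of `lam` to all indices with `L (x + k) = L x - (n - k)`. -/
def periodicExtension (k n : ℕ) (hk : 0 < k) (lam : Fin k → ℕ) (x : ℕ) : ℤ :=
  (lam ⟨x % k, Nat.mod_lt x hk⟩ : ℤ) - ((n - k : ℕ) : ℤ) * ((x / k : ℕ) : ℤ)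

theorem periodicExtension_add {k n : ℕ} (hk : 0 < k) (lam : Fin k → ℕ) (x : ℕ) :
    periodicExtension k n hk lam (x + k) =
      periodicExtension k n hk lam x - ((n - k : ℕ) : ℤ) := by
  simp only [periodicExtension, Nat.add_mod_right, Nat.add_div_right x hk]
  push_cast
  ring

theorem periodicExtension_fin {k n : ℕ} (hk : 0 < k) (lam : Fin k → ℕ) (i : Fin k) :
    periodicExtension k n hk lam i = lam i := by
  simp [periodicExtension, Nat.mod_eq_of_lt i.2, Nat.div_eq_of_lt i.2]

/-- The diagram cut out of the periodic extension by the window `j + 1, …, j + k` lies in the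
orbit. -/
theorem IsDiagram.exists_iterate_eq_window {k n : ℕ} (hk : 0 < k) {lam : Fin k → ℕ}
    (h : IsDiagram k n lam) (j : ℕ) :
    ∃ t, ∀ i : Fin k, (((cyc k n)^[t] lam i : ℕ) : ℤ) =
      periodicExtension k n hk lam (i + (j + 1)) - periodicExtension k n hk lam (j + k) := by
  induction j with
  | zero =>
    refine ⟨n - k - lam ⟨0, hk⟩ + 1, fun i => ?_⟩
    rw [h.iterate_cyc_drop hk]
    have h0 := h.2 ⟨0, hk⟩
    have e0 := periodicExtension_fin (n := n) hk lam ⟨0, hk⟩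
    have ek := periodicExtension_add (n := n) hk lam 0
    simp only [Nat.zero_add] at ek e0 ⊢
    rw [ek, e0]
    split_ifs with hi
    · rw [periodicExtension_fin hk lam ⟨i + 1, hi⟩]
      omega
    · have : (i : ℕ) + 1 = k := by omega
      rw [this, ← e0, ek]
      simp
  | succ j ih =>
    obtain ⟨t, ht⟩ := ih
    have hd := h.iterate_cyc t
    have h0 := hd.2 ⟨0, hk⟩
    have e0 := ht ⟨0, hk⟩
    simp only [Nat.zero_add] at e0
    have ek := periodicExtension_add (n := n) hk lam (j + 1)
    refine ⟨n - k - (cyc k n)^[t] lam ⟨0, hk⟩ + 1 + t, fun i => ?_⟩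
    rw [Function.iterate_add_apply, hd.iterate_cyc_drop hk, ek]
    dsimp only
    split_ifs with hi
    · have e1 := ht ⟨i + 1, hi⟩
      have : (i : ℕ) + 1 + (j + 1) = i + (j + 1 + 1) := by ring
      simp only [this] at e1
      omega
    · have : (i : ℕ) + (j + 1 + 1) = j + 1 + k := by omega
      rw [this, ek]
      simp

theorem IsDiagram.exists_isUpper {k n : ℕ} (hk : 0 < k) {lam : Fin k → ℕ}
    (h : IsDiagram k n lam) : ∃ t, IsUpper k n ((cyc k n)^[t] lam) := by
  have : Nonempty (Fin k) := ⟨⟨0, hk⟩⟩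
  obtain ⟨p, hp⟩ := Finite.exists_max fun p : Fin k => k * lam p + (n - k) * (p : ℕ)
  have height : ∀ x : ℕ, (k : ℤ) * periodicExtension k n hk lam x + ((n - k : ℕ) : ℤ) * x =
      ((k * lam ⟨x % k, Nat.mod_lt x hk⟩ + (n - k) * (x % k) : ℕ) : ℤ) := by
    intro x
    have hx : (x : ℤ) = (k : ℤ) * ((x / k : ℕ) : ℤ) + ((x % k : ℕ) : ℤ) := by
      exact_mod_cast (Nat.div_add_mod x k).symm
    rw [hx]
    simp only [periodicExtension]
    push_cast
    ring
  obtain ⟨t, ht⟩ := h.exists_iterate_eq_window hk p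
  refine ⟨t, fun i => ?_⟩
  have hmax : (k : ℤ) * periodicExtension k n hk lam (i + (p + 1)) +
        ((n - k : ℕ) : ℤ) * ((i + (p + 1) : ℕ) : ℤ) ≤
      (k : ℤ) * periodicExtension k n hk lam (p + k) +
        ((n - k : ℕ) : ℤ) * ((p + k : ℕ) : ℤ) := by
    rw [height, height]
    simp only [Nat.add_mod_right, Nat.mod_eq_of_lt p.2]
    exact_mod_cast hp ⟨_, Nat.mod_lt (i + (p + 1)) hk⟩
  have hi : ((k - 1 - (i : ℕ) : ℕ) : ℤ) = k - 1 - (i : ℕ) := by omega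
  zify
  rw [ht i, hi]
  push_cast at hmax ⊢
  linarith

/-- every `σ`-orbit in `Y_{k,n}` contains an upper triangular
diagram; consequently every `σ`-orbit contains a unique minimal upper triangular
diagram. -/
theorem exists_upper_in_orbit_and_unique_minUpper (k n : ℕ) (hk : 1 ≤ k)
    (hkn : k ≤ n) :
    (∀ lam : Fin k → ℕ, IsDiagram k n lam →
      ∃ t : ℕ, IsUpper k n ((cyc k n)^[t] lam)) ∧
    (∀ lam : Fin k → ℕ, IsDiagram k n lam →
      ∃! mu : Fin k → ℕ, (∃ t : ℕ, (cyc k n)^[t] lam = mu) ∧ IsMinUpper k n mu) := by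
  refine ⟨fun lam h => h.exists_isUpper hk, fun lam h => ?_⟩
  let S : Set (Lex (Fin k → ℕ)) :=
    {x | ∃ t, IsUpper k n ((cyc k n)^[t] lam) ∧ toLex ((cyc k n)^[t] lam) = x}
  have hS : S.Nonempty := by
    obtain ⟨t, ht⟩ := h.exists_isUpper hk
    exact ⟨_, t, ht, rfl⟩
  obtain ⟨_, ⟨s, hs, rfl⟩, hmin⟩ := WellFounded.has_min (wellFounded_lt (α := Lex (Fin k → ℕ))) S hS
  refine ⟨(cyc k n)^[s] lam, ⟨⟨s, rfl⟩, hs, fun t ht => ?_⟩, ?_⟩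
  · rw [lexLE_iff]
    rw [← Function.iterate_add_apply] at ht ⊢
    exact not_lt.1 (hmin _ ⟨t + s, ht, rfl⟩)
  · rintro _ ⟨⟨t, rfl⟩, hup, hle⟩
    obtain ⟨r, hr⟩ := h.exists_iterate_iterate_eq hk t s
    have h1 := hle r (by rwa [hr])
    rw [hr, lexLE_iff] at h1
    exact toLex.injective (le_antisymm h1 (not_lt.1 (hmin _ ⟨t, hup, rfl⟩)))
end

section
/- Let p be a prime number, m ≥ 1 an integer, and n = pm. Then the set {λ ∈ Y_{p,pm} : o(λ) < pm} is exactly the σ-orbit of θ_{p,pm}; in particular this set has exactly m elements and every λ in it satisfies o(λ) = m. -/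
/-- The strictly decreasing sequence `λ_i + (k - i)` (1-indexed) of positions of the
vertical boundary steps of a diagram. -/
def position {k : ℕ} (lam : Fin k → ℕ) (i : Fin k) : ℕ := lam i + (k - 1 - (i : ℕ))

/-- The set of positions of a diagram, read modulo `n`. -/
def positionSet {k : ℕ} (n : ℕ) (lam : Fin k → ℕ) : Finset (ZMod n) :=
  Finset.univ.image fun i => (position lam i : ZMod n)

namespace IsDiagram

variable {k n : ℕ} {lam mu : Fin k → ℕ}

theorem strictAnti_position (h : IsDiagram k n lam) : StrictAnti (position lam) := by
  intro i j hij
  have := h.1 i j hij.le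
  have hij' : (i : ℕ) < j := hij
  have := j.isLt
  simp only [position]
  omega

theorem position_lt (h : IsDiagram k n lam) (hkn : k ≤ n) (i : Fin k) : position lam i < n := by
  have := h.2 i
  have := i.isLt
  simp only [position]
  omega

theorem injective_cast_position (h : IsDiagram k n lam) (hkn : k ≤ n) :
    Function.Injective fun i => (position lam i : ZMod n) := by
  intro i j hij
  have hij' := (ZMod.natCast_eq_natCast_iff' _ _ _).1 hij
  rw [Nat.mod_eq_of_lt (h.position_lt hkn i), Nat.mod_eq_of_lt (h.position_lt hkn j)] at hij'
  exact h.strictAnti_position.injective hij'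

theorem card_positionSet (h : IsDiagram k n lam) (hkn : k ≤ n) :
    (positionSet n lam).card = k := by
  rw [positionSet, Finset.card_image_of_injective _ (h.injective_cast_position hkn)]
  simp

theorem range_position_subset (hl : IsDiagram k n lam) (hm : IsDiagram k n mu) (hkn : k ≤ n)
    (h : positionSet n lam = positionSet n mu) :
    Set.range (position lam) ⊆ Set.range (position mu) := by
  rintro _ ⟨i, rfl⟩
  have hi : (position lam i : ZMod n) ∈ positionSet n mu :=
    h ▸ Finset.mem_image_of_mem _ (Finset.mem_univ i)
  obtain ⟨j, -, hj⟩ := Finset.mem_image.1 hi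
  have hj' := (ZMod.natCast_eq_natCast_iff' _ _ _).1 hj
  rw [Nat.mod_eq_of_lt (hm.position_lt hkn j), Nat.mod_eq_of_lt (hl.position_lt hkn i)] at hj'
  exact ⟨j, hj'⟩

theorem eq_of_positionSet_eq (hl : IsDiagram k n lam) (hm : IsDiagram k n mu) (hkn : k ≤ n)
    (h : positionSet n lam = positionSet n mu) : lam = mu := by
  have key : position lam = position mu :=
    (StrictAnti.range_inj hl.strictAnti_position hm.strictAnti_position).1
      ((hl.range_position_subset hm hkn h).antisymm (hm.range_position_subset hl hkn h.symm))
  funext i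
  exact Nat.add_right_cancel (congrFun key i)

theorem isDiagram_cyc (h : IsDiagram k n lam) : IsDiagram k n (cyc k n lam) := by
  unfold cyc
  split_ifs with hc
  · exact ⟨fun i j hij => Nat.add_le_add_right (h.1 i j hij) 1, hc⟩
  · refine ⟨fun i j hij => ?_, fun i => ?_⟩
    · have hij' : (i : ℕ) ≤ j := hij
      dsimp only
      split_ifs with hj hi
      · exact h.1 _ _ (Fin.mk_le_mk.2 (by omega))
      · omega
      all_goals exact Nat.zero_le _
    · dsimp only
      split_ifs
      · exact h.2 _
      · exact Nat.zero_le _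

theorem isDiagram_iterate_cyc (h : IsDiagram k n lam) (t : ℕ) :
    IsDiagram k n ((cyc k n)^[t] lam) :=
  Function.Iterate.rec (IsDiagram k n) h (fun _ h => h.isDiagram_cyc) t

theorem positionSet_cyc (h : IsDiagram k n lam) (hkn : k ≤ n) :
    positionSet n (cyc k n lam) = (positionSet n lam).image (· + 1) := by
  refine Finset.eq_of_subset_of_card_le (fun x hx => ?_) ?_
  · obtain ⟨i, -, rfl⟩ := Finset.mem_image.1 hx
    simp only [positionSet, Finset.mem_image, Finset.mem_univ, true_and,
      exists_exists_eq_and]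
    have hi := i.isLt
    unfold cyc
    split_ifs with hc
    · exact ⟨i, by simp only [position]; push_cast; ring⟩
    · by_cases hik : (i : ℕ) + 1 < k
      · refine ⟨⟨i + 1, hik⟩, ?_⟩
        simp only [position, hik, dif_pos]
        rw [show k - 1 - (i : ℕ) = k - 1 - (i + 1) + 1 by omega]
        push_cast
        ring
      · push Not at hc
        obtain ⟨j, hj⟩ := hc
        refine ⟨⟨0, by omega⟩, ?_⟩
        have h0 := h.1 ⟨0, by omega⟩ j (Nat.zero_le _)
        have h1 := h.2 ⟨0, by omega⟩
        simp only [position, hik, dif_neg, not_false_iff]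
        rw [show k - 1 - (i : ℕ) = 0 by omega, ← Nat.cast_succ,
          show (lam ⟨0, by omega⟩ + (k - 1 - 0)).succ = n by omega]
        simp
  · rw [Finset.card_image_of_injective _ (add_left_injective 1), h.card_positionSet hkn,
      h.isDiagram_cyc.card_positionSet hkn]

theorem positionSet_iterate_cyc (h : IsDiagram k n lam) (hkn : k ≤ n) (t : ℕ) :
    positionSet n ((cyc k n)^[t] lam) =
      (positionSet n lam).image (· + (t : ZMod n)) := by
  induction t with
  | zero => simp
  | succ t ih =>
    rw [Function.iterate_succ_apply', (h.isDiagram_iterate_cyc t).positionSet_cyc hkn, ih,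
      Finset.image_image]
    congr 1
    funext x
    simp [add_assoc]

theorem iterate_cyc_eq_iff (hl : IsDiagram k n lam) (hm : IsDiagram k n mu) (hkn : k ≤ n)
    (t : ℕ) : (cyc k n)^[t] lam = mu ↔
      (positionSet n lam).image (· + (t : ZMod n)) = positionSet n mu := by
  rw [← hl.positionSet_iterate_cyc hkn]
  exact ⟨congrArg _, (hl.isDiagram_iterate_cyc t).eq_of_positionSet_eq hm hkn⟩

/-- Comparing the sums of the elements of `positionSet n lam` and of its translate. -/
theorem natCast_mul_eq_zero_of_iterate_cyc_eq (h : IsDiagram k n lam) (hkn : k ≤ n) {t : ℕ}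
    (ht : (cyc k n)^[t] lam = lam) : ((k * t : ℕ) : ZMod n) = 0 := by
  have hs := congrArg (fun s => ∑ x ∈ s, x) ((h.iterate_cyc_eq_iff h hkn t).1 ht)
  simp only [Finset.sum_image ((add_left_injective (t : ZMod n)).injOn), Finset.sum_add_distrib,
    Finset.sum_const, h.card_positionSet hkn, nsmul_eq_mul] at hs
  push_cast
  exact add_eq_left.1 hs

theorem isPeriodicPt_cyc (h : IsDiagram k n lam) (hkn : k ≤ n) :
    Function.IsPeriodicPt (cyc k n) n lam :=
  (h.iterate_cyc_eq_iff h hkn n).2 (by simp)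

end IsDiagram

theorem orbLen_eq_minimalPeriod (k n : ℕ) (lam : Fin k → ℕ) :
    orbLen k n lam = Function.minimalPeriod (cyc k n) lam := by
  by_cases h : lam ∈ Function.periodicPts (cyc k n)
  · have hmem : Function.minimalPeriod (cyc k n) lam ∈ {t | 0 < t ∧ (cyc k n)^[t] lam = lam} :=
      ⟨Function.minimalPeriod_pos_of_mem_periodicPts h, Function.iterate_minimalPeriod⟩
    obtain ⟨hpos, hper⟩ := Nat.sInf_mem ⟨_, hmem⟩
    exact le_antisymm (Nat.sInf_le hmem) (Function.IsPeriodicPt.minimalPeriod_le hpos hper)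
  · rw [Function.minimalPeriod_eq_zero_of_notMem_periodicPts h, orbLen, Nat.sInf_eq_zero]
    exact Or.inr (Set.eq_empty_of_forall_notMem fun t ht => h ⟨t, ht.1, ht.2⟩)

theorem isDiagram_theta (k m : ℕ) : IsDiagram k (k * m) (theta k m) := by
  refine ⟨fun i j hij => Nat.mul_le_mul_right _ (Nat.sub_le_sub_left hij _), fun i => ?_⟩
  rw [← Nat.mul_sub_one]
  exact Nat.mul_le_mul_right _ (by omega)

theorem position_theta {k m : ℕ} (hm : 1 ≤ m) (i : Fin k) :
    position (theta k m) i = (k - 1 - (i : ℕ)) * m := by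
  rw [position, theta, ← Nat.mul_succ, Nat.succ_eq_add_one, Nat.sub_add_cancel hm]

theorem iterate_cyc_theta {k m : ℕ} (hk : 1 ≤ k) (hm : 1 ≤ m) :
    (cyc k (k * m))^[m] (theta k m) = theta k m := by
  have hkn : k ≤ k * m := Nat.le_mul_of_pos_right k hm
  have ht := isDiagram_theta k m
  rw [ht.iterate_cyc_eq_iff ht hkn]
  refine Finset.eq_of_subset_of_card_le (fun x hx => ?_)
    (Finset.card_image_of_injective _ (add_left_injective _)).ge
  simp only [positionSet, Finset.mem_image, Finset.mem_univ, true_and, exists_exists_eq_and] at hx ⊢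
  obtain ⟨i, rfl⟩ := hx
  have hi := i.isLt
  simp only [position_theta hm, ← Nat.cast_add, ← Nat.succ_mul]
  by_cases h0 : (i : ℕ) = 0
  · refine ⟨⟨k - 1, by omega⟩, ?_⟩
    rw [show (k - 1 - (i : ℕ)).succ = k by omega, ZMod.natCast_self]
    simp
  · refine ⟨⟨i - 1, by omega⟩, ?_⟩
    rw [show k - 1 - ((i : ℕ) - 1) = (k - 1 - (i : ℕ)).succ by omega]

/-- A diagram fixed by `σ^[m]` lies in the orbit of `θ`. -/
theorem IsDiagram.exists_iterate_cyc_theta {k m : ℕ} {lam : Fin k → ℕ} (hk : 1 ≤ k) (hm : 1 ≤ m)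
    (h : IsDiagram k (k * m) lam) (hper : (cyc k (k * m))^[m] lam = lam) :
    ∃ t : ℕ, (cyc k (k * m))^[t] (theta k m) = lam := by
  have hkn : k ≤ k * m := Nat.le_mul_of_pos_right k hm
  have ht := isDiagram_theta k m
  refine ⟨position lam ⟨0, hk⟩, (ht.iterate_cyc_eq_iff h hkn _).2 ?_⟩
  refine Finset.eq_of_subset_of_card_le (fun x hx => ?_) ?_
  · obtain ⟨_, hy, rfl⟩ := Finset.mem_image.1 hx
    obtain ⟨i, -, rfl⟩ := Finset.mem_image.1 hy
    have hj : (cyc k (k * m))^[(k - 1 - (i : ℕ)) * m] lam = lam :=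
      Function.IsPeriodicPt.const_mul (show Function.IsPeriodicPt _ m lam from hper) _
    rw [← (h.iterate_cyc_eq_iff h hkn _).1 hj, add_comm, position_theta hm]
    exact Finset.mem_image_of_mem _ (Finset.mem_image_of_mem _ (Finset.mem_univ _))
  · rw [Finset.card_image_of_injective _ (add_left_injective _), ht.card_positionSet hkn,
      h.card_positionSet hkn]

theorem orbLen_eq_of_lt {p m : ℕ} {lam : Fin p → ℕ} (hp : p.Prime) (hm : 1 ≤ m)
    (h : IsDiagram p (p * m) lam) (hlt : orbLen p (p * m) lam < p * m) :
    orbLen p (p * m) lam = m := by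
  have hkn : p ≤ p * m := Nat.le_mul_of_pos_right p hm
  rw [orbLen_eq_minimalPeriod] at hlt ⊢
  have hdvd := (h.isPeriodicPt_cyc hkn).minimalPeriod_dvd
  have hzero := h.natCast_mul_eq_zero_of_iterate_cyc_eq hkn
    (Function.iterate_minimalPeriod (f := cyc p (p * m)) (x := lam))
  rw [ZMod.natCast_eq_zero_iff] at hzero
  obtain ⟨e, he⟩ := Nat.dvd_of_mul_dvd_mul_left hp.pos hzero
  rw [he, mul_comm p m] at hdvd hlt
  rcases (Nat.dvd_prime hp).1 (Nat.dvd_of_mul_dvd_mul_left hm hdvd) with rfl | rfl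
  · rw [he, mul_one]
  · exact absurd hlt (lt_irrefl _)

/-- for a prime `p` and `n = pm`, the set of diagrams in `Y_{p,pm}`
with short orbit `o(λ) < pm` is exactly the `σ`-orbit of `θ_{p,pm}`; in
particular it has exactly `m` elements and every element has `o(λ) = m`. -/
theorem short_diagrams_eq_orbit_theta (p m : ℕ) (hp : p.Prime) (hm : 1 ≤ m) :
    {lam : Fin p → ℕ | IsDiagram p (p * m) lam ∧ orbLen p (p * m) lam < p * m} =
      {lam : Fin p → ℕ | ∃ t : ℕ, (cyc p (p * m))^[t] (theta p m) = lam} ∧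
    {lam : Fin p → ℕ |
      IsDiagram p (p * m) lam ∧ orbLen p (p * m) lam < p * m}.ncard = m ∧
    ∀ lam : Fin p → ℕ, IsDiagram p (p * m) lam → orbLen p (p * m) lam < p * m →
      orbLen p (p * m) lam = m := by
  have ht := isDiagram_theta p m
  have hfix := iterate_cyc_theta (k := p) hp.pos hm
  have hlt : m < p * m := by nlinarith [hp.two_le]
  have hset : {lam : Fin p → ℕ | IsDiagram p (p * m) lam ∧ orbLen p (p * m) lam < p * m} =
      {lam : Fin p → ℕ | ∃ t : ℕ, (cyc p (p * m))^[t] (theta p m) = lam} := by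
    ext lam
    constructor
    · rintro ⟨h, ho⟩
      refine h.exists_iterate_cyc_theta hp.pos hm ?_
      have hm' := orbLen_eq_of_lt hp hm h ho
      rw [orbLen_eq_minimalPeriod] at hm'
      nth_rewrite 2 [← hm']
      exact Function.iterate_minimalPeriod
    · rintro ⟨t, rfl⟩
      have hper : Function.IsPeriodicPt (cyc p (p * m)) m (theta p m) := hfix
      rw [Set.mem_ofPred_eq, orbLen_eq_minimalPeriod]
      exact ⟨ht.isDiagram_iterate_cyc t, ((hper.apply_iterate t).minimalPeriod_le hm).trans_lt hlt⟩
  refine ⟨hset, ?_, fun lam h ho => orbLen_eq_of_lt hp hm h ho⟩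
  have htheta : Function.minimalPeriod (cyc p (p * m)) (theta p m) = m := by
    have hmem := hset.ge (⟨0, rfl⟩ : theta p m ∈ {lam | ∃ t, (cyc p (p * m))^[t] (theta p m) = lam})
    rw [← orbLen_eq_minimalPeriod]
    exact orbLen_eq_of_lt hp hm hmem.1 hmem.2
  have himage : {lam : Fin p → ℕ | ∃ t : ℕ, (cyc p (p * m))^[t] (theta p m) = lam} =
      ((cyc p (p * m))^[·] (theta p m)) '' Set.Iio m := by
    ext lam
    constructor
    · rintro ⟨t, rfl⟩
      refine ⟨t % m, Nat.mod_lt _ hm, ?_⟩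
      exact Function.IsPeriodicPt.iterate_mod_apply hfix t
    · rintro ⟨t, -, rfl⟩
      exact ⟨t, rfl⟩
  have hinj := Function.iterate_injOn_Iio_minimalPeriod (f := cyc p (p * m)) (x := theta p m)
  rw [htheta] at hinj
  rw [hset, himage, hinj.ncard_image, ← Finset.coe_Iio, Set.ncard_coe_finset,
    Nat.card_Iio]
end
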